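/- For every n ≥ 0, F_{2n}^I(x,y,q) = y^n q^{2n(n−1)} + Σ_{j=0}^{n−1} x y^j q^{4nj − 2j² − 4j + 2n − 1} F_{2n−2j−1}^I(x,y,q), as an identity in ℤ[x,y,q]. -/

import Mathlib

open Finset MvPolynomial

open scoped Classical

/-- `σ` (a permutation of `[n]` in one-line notation `σ 0, …, σ (n-1)`) contains the
pattern `π` (given by its one-line notation as a function `Fin m → Fin m`) if some
subsequence of `σ` is order isomorphic to `π`. -/
def PermContains {n m : ℕ} (σ : Equiv.Perm (Fin n)) (π : Fin m → Fin m) : Prop :=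
  ∃ f : Fin m → Fin n, (∀ a b : Fin m, a < b → f a < f b) ∧
    ∀ a b : Fin m, σ (f a) < σ (f b) ↔ π a < π b

/-- `σ` avoids the pattern `π`. -/
def PermAvoids {n m : ℕ} (σ : Equiv.Perm (Fin n)) (π : Fin m → Fin m) : Prop :=
  ¬ PermContains σ π

/-- The value `σ i` of the one-line notation of `σ`, as a natural number (0-based). -/
def permVal {n : ℕ} (σ : Equiv.Perm (Fin n)) (i : ℕ) : ℕ :=
  if h : i < n then (σ ⟨i, h⟩ : ℕ) else 0

/-- `inv σ` : the number of inversions, i.e. pairs of positions `i < j` with `σ i > σ j`. -/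
def invStat {n : ℕ} (σ : Equiv.Perm (Fin n)) : ℕ :=
  ((Finset.range n ×ˢ Finset.range n).filter
    fun p => p.1 < p.2 ∧ permVal σ p.2 < permVal σ p.1).card

/-- `maj σ` : the sum of all (1-based) indices `i` with `σ(i) > σ(i+1)`; with 0-based
positions, a descent at positions `i, i+1` contributes `i + 1`. -/
def majStat {n : ℕ} (σ : Equiv.Perm (Fin n)) : ℕ :=
  ∑ i ∈ Finset.range (n - 1), if permVal σ (i + 1) < permVal σ i then i + 1 else 0

/-- The number of ascents of `σ`; for `σ ∈ Sₙ(123,132,213)` (a reverse layered matching)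
this equals `d σ`, the number of doubleton blocks. -/
def ascStat {n : ℕ} (σ : Equiv.Perm (Fin n)) : ℕ :=
  ((Finset.range (n - 1)).filter fun i => permVal σ i < permVal σ (i + 1)).card

/-- The number of descents of `σ`; for `σ ∈ Sₙ(231,312,321)` (a layered matching)
this equals `d σ`, the number of doubleton blocks. -/
def descStat {n : ℕ} (σ : Equiv.Perm (Fin n)) : ℕ :=
  ((Finset.range (n - 1)).filter fun i => permVal σ (i + 1) < permVal σ i).card

/-- `Sₙ(123, 132, 213)` : permutations of `[n]` avoiding `123`, `132` and `213`
(patterns written 0-based). -/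
noncomputable def S123 (n : ℕ) : Finset (Equiv.Perm (Fin n)) :=
  Finset.univ.filter fun σ =>
    PermAvoids σ ![0, 1, 2] ∧ PermAvoids σ ![0, 2, 1] ∧ PermAvoids σ ![1, 0, 2]

/-- `Sₙ(231, 312, 321)` : permutations of `[n]` avoiding `231`, `312` and `321`
(patterns written 0-based). -/
noncomputable def S231 (n : ℕ) : Finset (Equiv.Perm (Fin n)) :=
  Finset.univ.filter fun σ =>
    PermAvoids σ ![1, 2, 0] ∧ PermAvoids σ ![2, 0, 1] ∧ PermAvoids σ ![2, 1, 0]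

/-- `Fₙᴵ(x, y, q) = Σ_{σ ∈ Sₙ(123,132,213)} x^(s σ) * y^(d σ) * q^(inv σ)` in `ℤ[x,y,q]`,
where `d σ = ascStat σ` is the number of doubletons and `s σ = n - 2 * d σ` the number of
singletons; here `x = X 0`, `y = X 1`, `q = X 2`. -/
noncomputable def FI (n : ℕ) : MvPolynomial (Fin 3) ℤ :=
  ∑ σ ∈ S123 n, X 0 ^ (n - 2 * ascStat σ) * X 1 ^ ascStat σ * X 2 ^ invStat σ

/-- The permutation whose one-line notation starts with `v` and continues with the entries of
`σ`, shifted so as to skip the value `v`. -/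
def consPerm {n : ℕ} (v : Fin (n + 1)) (σ : Equiv.Perm (Fin n)) : Equiv.Perm (Fin (n + 1)) :=
  (finSuccEquiv' 0).trans (σ.optionCongr.trans (finSuccEquiv' v).symm)

@[simp]
lemma consPerm_zero {n : ℕ} (v : Fin (n + 1)) (σ : Equiv.Perm (Fin n)) :
    consPerm v σ 0 = v := by
  simp [consPerm]

@[simp]
lemma consPerm_succ {n : ℕ} (v : Fin (n + 1)) (σ : Equiv.Perm (Fin n)) (i : Fin n) :
    consPerm v σ i.succ = v.succAbove (σ i) := by
  have h : finSuccEquiv' (0 : Fin (n + 1)) i.succ = some i := by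
    rw [← Fin.succAbove_zero_apply, finSuccEquiv'_succAbove]
  simp [consPerm, h]

lemma consPerm_bijective (n : ℕ) :
    Function.Bijective fun p : Fin (n + 1) × Equiv.Perm (Fin n) => consPerm p.1 p.2 := by
  rw [Fintype.bijective_iff_injective_and_card]
  refine ⟨?_, by simp [Fintype.card_perm, Nat.factorial_succ]⟩
  rintro ⟨v, σ⟩ ⟨w, τ⟩ h
  have hvw : v = w := by simpa using congrArg (fun ρ : Equiv.Perm (Fin (n + 1)) => ρ 0) h
  subst hvw
  congr 1
  ext i : 1
  have hi := congrArg (fun ρ : Equiv.Perm (Fin (n + 1)) => ρ i.succ) h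
  simpa using hi

lemma exists_eq_consPerm {n : ℕ} (σ : Equiv.Perm (Fin (n + 1))) :
    ∃ v τ, σ = consPerm v τ := by
  obtain ⟨⟨v, τ⟩, h⟩ := (consPerm_bijective n).surjective σ
  exact ⟨v, τ, h.symm⟩

lemma sum_perm_succ {n : ℕ} {M : Type*} [AddCommMonoid M] (f : Equiv.Perm (Fin (n + 1)) → M) :
    ∑ σ, f σ = ∑ v : Fin (n + 1), ∑ τ : Equiv.Perm (Fin n), f (consPerm v τ) := by
  rw [← Fintype.sum_prod_type' (fun v τ => f (consPerm v τ))]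
  exact (Fintype.sum_bijective _ (consPerm_bijective n) _ _ fun _ => rfl).symm

lemma permContains_three_iff {n : ℕ} (σ : Equiv.Perm (Fin n)) (π : Fin 3 → Fin 3) :
    PermContains σ π ↔ ∃ i j k : Fin n, i < j ∧ j < k ∧
      ∀ a b : Fin 3, σ (![i, j, k] a) < σ (![i, j, k] b) ↔ π a < π b := by
  constructor
  · rintro ⟨f, hf, h⟩
    have hfe : ![f 0, f 1, f 2] = f := by
      funext a
      fin_cases a <;> rfl
    exact ⟨f 0, f 1, f 2, hf 0 1 (by decide), hf 1 2 (by decide), by rwa [hfe]⟩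
  · rintro ⟨i, j, k, hij, hjk, h⟩
    refine ⟨![i, j, k], ?_, h⟩
    intro a b hab
    fin_cases a <;> fin_cases b <;> simp_all
    exact hij.trans hjk

lemma mem_S123_iff_triple {n : ℕ} (σ : Equiv.Perm (Fin n)) :
    σ ∈ S123 n ↔ ∀ i j k : Fin n, i < j → j < k → σ k < σ i := by
  simp only [S123, mem_filter, mem_univ, true_and, PermAvoids, permContains_three_iff]
  constructor
  · rintro ⟨h₁, h₂, h₃⟩ i j k hij hjk
    by_contra hki
    have hik : σ i < σ k := lt_of_le_of_ne (not_lt.1 hki) fun h =>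
      (hij.trans hjk).ne (σ.injective h)
    have hij' : σ i ≠ σ j := fun h => hij.ne (σ.injective h)
    have hjk' : σ j ≠ σ k := fun h => hjk.ne (σ.injective h)
    rcases lt_or_gt_of_ne hij' with h | h
    · rcases lt_or_gt_of_ne hjk' with h' | h'
      · refine h₁ ⟨i, j, k, hij, hjk, ?_⟩
        simp [Fin.forall_fin_succ]
        omega
      · refine h₂ ⟨i, j, k, hij, hjk, ?_⟩
        simp [Fin.forall_fin_succ]
        omega
    · refine h₃ ⟨i, j, k, hij, hjk, ?_⟩
      simp [Fin.forall_fin_succ]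
      omega
  · intro h
    refine ⟨?_, ?_, ?_⟩ <;>
    · rintro ⟨i, j, k, hij, hjk, hp⟩
      exact (h i j k hij hjk).asymm ((hp 0 2).2 (by decide))

/-- Avoiding `123`, `132`, `213` means that every entry exceeds all entries at distance at
least two to its right. -/
lemma mem_S123_iff {n : ℕ} (σ : Equiv.Perm (Fin n)) :
    σ ∈ S123 n ↔ ∀ i k : Fin n, (i : ℕ) + 1 < k → σ k < σ i := by
  rw [mem_S123_iff_triple]
  constructor
  · intro h i k hik
    exact h i ⟨i + 1, by omega⟩ k (by simp [Fin.lt_def]) (by simpa [Fin.lt_def] using hik)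
  · intro h i j k hij hjk
    exact h i k (by omega)

lemma consPerm_mem_S123_iff {n : ℕ} (v : Fin (n + 1)) (σ : Equiv.Perm (Fin n)) :
    consPerm v σ ∈ S123 (n + 1) ↔
      σ ∈ S123 n ∧ ∀ k : Fin n, 0 < (k : ℕ) → (σ k).castSucc < v := by
  simp only [mem_S123_iff, Fin.forall_fin_succ (P := fun i : Fin (n + 1) => ∀ k, _),
    Fin.forall_fin_succ (n := n), consPerm_zero, consPerm_succ,
    Fin.succAbove_lt_iff_castSucc_lt, Fin.val_zero, Fin.val_succ,
    (Fin.strictMono_succAbove v).lt_iff_lt]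
  constructor
  · rintro ⟨⟨-, h⟩, h'⟩
    exact ⟨fun i k hik => (h' i).2 k (by omega), fun k hk => h k (by omega)⟩
  · rintro ⟨h', h⟩
    exact ⟨⟨by omega, fun k hk => h k (by omega)⟩,
      fun i => ⟨by omega, fun k hk => h' i k (by omega)⟩⟩

lemma consPerm_last_mem_S123_iff {n : ℕ} (σ : Equiv.Perm (Fin n)) :
    consPerm (Fin.last n) σ ∈ S123 (n + 1) ↔ σ ∈ S123 n := by
  rw [consPerm_mem_S123_iff]
  exact and_iff_left fun k _ => Fin.castSucc_lt_last _

lemma consPerm_castSucc_last_mem_S123_iff {n : ℕ} (u : Fin (n + 1)) (τ : Equiv.Perm (Fin n)) :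
    consPerm (Fin.last n).castSucc (consPerm u τ) ∈ S123 (n + 2) ↔
      u = Fin.last n ∧ τ ∈ S123 n := by
  rw [consPerm_mem_S123_iff]
  constructor
  · rintro ⟨h, h'⟩
    have hu : u = Fin.last n := by
      obtain ⟨k, hk⟩ := (consPerm u τ).surjective (Fin.last n)
      rcases Nat.eq_zero_or_pos (k : ℕ) with h0 | h0
      · obtain rfl : k = 0 := Fin.ext h0
        simpa using hk
      · exact absurd (h' k h0) (by simp [hk])
    subst hu
    exact ⟨rfl, (consPerm_last_mem_S123_iff τ).1 h⟩
  · rintro ⟨rfl, h⟩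
    refine ⟨(consPerm_last_mem_S123_iff τ).2 h, fun k hk => ?_⟩
    rw [Fin.castSucc_lt_castSucc_iff, Fin.lt_last_iff_ne_last]
    intro hk'
    have h0 : k = 0 := (consPerm (Fin.last n) τ).injective (by rw [hk', consPerm_zero])
    simp [h0] at hk

lemma consPerm_castSucc_castSucc_notMem_S123 {n : ℕ} (u : Fin n)
    (σ : Equiv.Perm (Fin (n + 1))) : consPerm u.castSucc.castSucc σ ∉ S123 (n + 2) := by
  rw [consPerm_mem_S123_iff]
  rintro ⟨-, h⟩
  have key : ∀ w : Fin (n + 1), u.castSucc ≤ w → σ.symm w = 0 := by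
    intro w hw
    by_contra hne
    have := h (σ.symm w) (Nat.pos_of_ne_zero fun h0 => hne (Fin.ext h0))
    rw [Equiv.apply_symm_apply, Fin.castSucc_lt_castSucc_iff] at this
    exact absurd this (not_lt.2 hw)
  have h2 := (key _ le_rfl).trans (key (Fin.last n) (Fin.le_last _)).symm
  exact (Fin.castSucc_lt_last u).ne (σ.symm.injective h2)

lemma permVal_coe {n : ℕ} (σ : Equiv.Perm (Fin n)) (i : Fin n) : permVal σ i = σ i := by
  simp [permVal]

lemma invStat_eq_sum {n : ℕ} (σ : Equiv.Perm (Fin n)) :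
    invStat σ = ∑ i : Fin n, ∑ j : Fin n, if i < j ∧ σ j < σ i then 1 else 0 := by
  rw [invStat, card_filter, sum_product, sum_range]
  refine sum_congr rfl fun i _ => ?_
  rw [sum_range]
  simp only [permVal_coe, ← Fin.lt_def]

lemma invStat_consPerm {n : ℕ} (v : Fin (n + 1)) (σ : Equiv.Perm (Fin n)) :
    invStat (consPerm v σ) = v + invStat σ := by
  have hv : ∑ j : Fin n, (if v.succAbove (σ j) < v then 1 else 0) = (v : ℕ) := by
    rw [Equiv.sum_comp σ (fun j => if v.succAbove j < v then 1 else 0)]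
    have h := Fin.sum_univ_succAbove (fun w : Fin (n + 1) => if w < v then 1 else 0) v
    have hc : ∑ w : Fin (n + 1), (if w < v then 1 else 0) = (v : ℕ) := by
      simp [filter_gt_eq_Iio]
    simpa [hc] using h.symm
  simp only [invStat_eq_sum]
  rw [Fin.sum_univ_succ]
  simp only [Fin.sum_univ_succ (n := n), consPerm_zero, consPerm_succ, lt_irrefl, false_and,
    if_false, zero_add, Fin.succ_pos, true_and, Fin.succ_lt_succ_iff, Fin.not_lt_zero,
    (Fin.strictMono_succAbove v).lt_iff_lt, hv]

lemma permVal_consPerm_zero {n : ℕ} (v : Fin (n + 1)) (σ : Equiv.Perm (Fin n)) :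
    permVal (consPerm v σ) 0 = v := by
  simpa using permVal_coe (consPerm v σ) 0

lemma permVal_consPerm_succ {n : ℕ} (v : Fin (n + 1)) (σ : Equiv.Perm (Fin n)) {i : ℕ}
    (hi : i < n) : permVal (consPerm v σ) (i + 1) = v.succAbove (σ ⟨i, hi⟩) := by
  rw [← consPerm_succ, ← permVal_coe, Fin.val_succ]

lemma ascStat_consPerm {n : ℕ} (v : Fin (n + 2)) (σ : Equiv.Perm (Fin (n + 1))) :
    ascStat (consPerm v σ) = ascStat σ + if v ≤ (σ 0).castSucc then 1 else 0 := by
  simp only [ascStat, card_filter, Nat.add_sub_cancel]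
  rw [sum_range_succ']
  congr 1
  · refine sum_congr rfl fun i hi => ?_
    have hi' := mem_range.1 hi
    refine if_congr ?_ rfl rfl
    rw [permVal_consPerm_succ v σ (show i < n + 1 by omega),
      permVal_consPerm_succ v σ (show i + 1 < n + 1 by omega), ← Fin.lt_def,
      (Fin.strictMono_succAbove v).lt_iff_lt, Fin.lt_def, ← permVal_coe, ← permVal_coe]
  · refine if_congr ?_ rfl rfl
    rw [permVal_consPerm_zero, permVal_consPerm_succ v σ (Nat.succ_pos n), ← Fin.lt_def,
      Fin.lt_succAbove_iff_le_castSucc]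
    rfl

lemma ascStat_consPerm_last {n : ℕ} (σ : Equiv.Perm (Fin n)) :
    ascStat (consPerm (Fin.last n) σ) = ascStat σ := by
  cases n with
  | zero => simp [ascStat]
  | succ n => simp [ascStat_consPerm, Fin.last_le_iff]

lemma ascStat_consPerm_consPerm_last {n : ℕ} (τ : Equiv.Perm (Fin n)) :
    ascStat (consPerm (Fin.last n).castSucc (consPerm (Fin.last n) τ)) = ascStat τ + 1 := by
  simp [ascStat_consPerm, ascStat_consPerm_last]

lemma exists_of_mem_S123 {n : ℕ} {σ : Equiv.Perm (Fin (n + 2))} (hσ : σ ∈ S123 (n + 2)) :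
    (∃ τ ∈ S123 (n + 1), σ = consPerm (Fin.last (n + 1)) τ) ∨
      ∃ τ ∈ S123 n, σ = consPerm (Fin.last n).castSucc (consPerm (Fin.last n) τ) := by
  obtain ⟨v, ρ, rfl⟩ := exists_eq_consPerm σ
  obtain ⟨u, τ, rfl⟩ := exists_eq_consPerm ρ
  induction v using Fin.lastCases with
  | last => exact .inl ⟨_, (consPerm_last_mem_S123_iff _).1 hσ, rfl⟩
  | cast v =>
    induction v using Fin.lastCases with
    | last =>
      obtain ⟨rfl, hτ⟩ := (consPerm_castSucc_last_mem_S123_iff u τ).1 hσ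
      exact .inr ⟨τ, hτ, rfl⟩
    | cast v => exact absurd hσ (consPerm_castSucc_castSucc_notMem_S123 v _)

lemma two_mul_ascStat_le : ∀ {n : ℕ} {σ : Equiv.Perm (Fin n)}, σ ∈ S123 n → 2 * ascStat σ ≤ n
  | 0, _, _ => by simp [ascStat]
  | 1, _, _ => by simp [ascStat]
  | n + 2, _, hσ => by
    rcases exists_of_mem_S123 hσ with ⟨τ, hτ, rfl⟩ | ⟨τ, hτ, rfl⟩
    · have := two_mul_ascStat_le hτ
      rw [ascStat_consPerm_last]
      omega
    · have := two_mul_ascStat_le hτ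
      rw [ascStat_consPerm_consPerm_last]
      omega

lemma FI_eq_sum_ite (n : ℕ) :
    FI n = ∑ σ : Equiv.Perm (Fin n), if σ ∈ S123 n then
      X 0 ^ (n - 2 * ascStat σ) * X 1 ^ ascStat σ * X 2 ^ invStat σ else 0 := by
  rw [FI, ← sum_filter]
  congr 1
  ext σ
  simp

lemma FI_zero : FI 0 = 1 := by
  have h : ∀ σ : Equiv.Perm (Fin 0), σ ∈ S123 0 := fun σ => (mem_S123_iff σ).2 fun i => i.elim0
  simp [FI_eq_sum_ite, h, ascStat, invStat]

lemma FI_add_two (n : ℕ) :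
    FI (n + 2) = X 0 * X 2 ^ (n + 1) * FI (n + 1) + X 1 * X 2 ^ (2 * n) * FI n := by
  rw [FI_eq_sum_ite (n + 2), sum_perm_succ, Fin.sum_univ_castSucc, Fin.sum_univ_castSucc]
  simp only [consPerm_castSucc_castSucc_notMem_S123, if_false, sum_const_zero, zero_add]
  rw [add_comm]
  congr 1
  · rw [FI_eq_sum_ite, mul_sum]
    refine sum_congr rfl fun σ _ => ?_
    simp only [consPerm_last_mem_S123_iff]
    split_ifs with hσ
    · have hs : n + 2 - 2 * ascStat σ = n + 1 - 2 * ascStat σ + 1 := by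
        have := two_mul_ascStat_le hσ
        omega
      rw [ascStat_consPerm_last, invStat_consPerm, Fin.val_last, hs]
      ring
    · simp
  · rw [sum_perm_succ, Fin.sum_univ_castSucc]
    simp only [consPerm_castSucc_last_mem_S123_iff, (Fin.castSucc_lt_last _).ne, false_and,
      if_false, sum_const_zero, zero_add, true_and]
    rw [FI_eq_sum_ite, mul_sum]
    refine sum_congr rfl fun τ _ => ?_
    split_ifs with hτ
    · have hs : n + 2 - 2 * (ascStat τ + 1) = n - 2 * ascStat τ := by omega
      rw [ascStat_consPerm_consPerm_last, invStat_consPerm, invStat_consPerm, Fin.val_castSucc,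
        Fin.val_last, hs]
      ring
    · simp

lemma exponent_succ {n j : ℕ} (hj : j < n) :
    4 * (n + 1) * (j + 1) - 2 * (j + 1) ^ 2 - 4 * (j + 1) + 2 * (n + 1) - 1 =
      2 * (2 * n) + (4 * n * j - 2 * j ^ 2 - 4 * j + 2 * n - 1) := by
  obtain ⟨m, rfl⟩ := Nat.exists_eq_add_of_lt hj
  have h₁ : 4 * (j + m + 1 + 1) * (j + 1) - 2 * (j + 1) ^ 2 - 4 * (j + 1) =
      2 * j ^ 2 + 4 * m * j + 4 * j + 4 * m + 2 := by
    rw [Nat.sub_sub]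
    apply Nat.sub_eq_of_eq_add
    ring
  have h₂ : 4 * (j + m + 1) * j - 2 * j ^ 2 - 4 * j = 2 * j ^ 2 + 4 * m * j := by
    rw [Nat.sub_sub]
    apply Nat.sub_eq_of_eq_add
    ring
  rw [h₁, h₂]
  omega

/-- `F_{2n}ᴵ = yⁿ q^(2n(n-1)) + Σ_{j=0}^{n-1} x yʲ q^(4nj - 2j² - 4j + 2n - 1) F_{2n-2j-1}ᴵ`
in `ℤ[x,y,q]`. -/
theorem stmt16 (n : ℕ) :
    FI (2 * n) = X 1 ^ n * X 2 ^ (2 * n * (n - 1)) +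
      ∑ j ∈ Finset.range n,
        X 0 * X 1 ^ j * X 2 ^ (4 * n * j - 2 * j ^ 2 - 4 * j + 2 * n - 1) *
          FI (2 * n - 2 * j - 1) := by
  induction n with
  | zero => simp [FI_zero]
  | succ n ih =>
    have hpow : (2 * n + 2) * (n + 1 - 1) = 2 * (2 * n) + 2 * n * (n - 1) := by
      cases n with
      | zero => simp
      | succ n =>
        simp only [Nat.add_sub_cancel]
        ring
    have hsum : ∀ j ∈ range n,
        (X 0 * X 1 ^ (j + 1) * X 2 ^ (4 * (n + 1) * (j + 1) - 2 * (j + 1) ^ 2 - 4 * (j + 1) +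
          2 * (n + 1) - 1) * FI (2 * (n + 1) - 2 * (j + 1) - 1) : MvPolynomial (Fin 3) ℤ) =
        X 1 * X 2 ^ (2 * (2 * n)) *
          (X 0 * X 1 ^ j * X 2 ^ (4 * n * j - 2 * j ^ 2 - 4 * j + 2 * n - 1) *
            FI (2 * n - 2 * j - 1)) := by
      intro j hj
      rw [exponent_succ (mem_range.1 hj),
        show 2 * (n + 1) - 2 * (j + 1) - 1 = 2 * n - 2 * j - 1 by omega, pow_add, pow_succ]
      ring
    have hzero : 4 * (n + 1) * 0 - 2 * 0 ^ 2 - 4 * 0 + 2 * (n + 1) - 1 = 2 * n + 1 := by omega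
    rw [sum_range_succ', sum_congr rfl hsum, ← mul_sum, hzero,
      show 2 * (n + 1) - 2 * 0 - 1 = 2 * n + 1 by omega, show 2 * (n + 1) = 2 * n + 2 by ring,
      FI_add_two, ih, hpow, pow_add (X 2) (2 * (2 * n))]
    ring
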